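/- arXiv:1403.4544 — 2 statements merged into one kernel-verified Lean document; each statement's English description precedes it below -/
import Mathlib

section
/- (Lemma 2.2) If β_1 ≠ 0, z_1 ≠ 0 and sgn(β_1) ≠ sgn(z_1), then the minimal scaled Lasso loss equals β_1², i.e., inf_{λ≥0} nL_p(λ) = β_1²; in particular nL_p(λ) ≥ β_1² for all λ ≥ 0. -/
open Finset

/-- Soft-thresholding operator `η(z, λ) = sgn(z)·max(|z|−λ, 0)`. -/
noncomputable def eta (z lam : ℝ) : ℝ := Real.sign z * max (|z| - lam) 0

/-- Scaled Lasso loss with `p` predictors: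
`nL_p(λ) = (β₁ − η(z₁,λ))² + Σ_{j=2}^p η(z_j,λ)²`. -/
noncomputable def nLp (p : ℕ) (z : ℕ → ℝ) (β₁ : ℝ) (lam : ℝ) : ℝ :=
  (β₁ - eta (z 1) lam) ^ 2 + ∑ j ∈ Finset.Icc 2 p, (eta (z j) lam) ^ 2

/-- Scaled Lasso loss with one predictor: `nL_1(λ) = (β₁ − η(z₁,λ))²`. -/
noncomputable def nL1 (z : ℕ → ℝ) (β₁ : ℝ) (lam : ℝ) : ℝ :=
  (β₁ - eta (z 1) lam) ^ 2

/-- Infimum of a loss function over `λ ≥ 0`. -/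
noncomputable def infLoss (f : ℝ → ℝ) : ℝ := ⨅ lam : {l : ℝ // 0 ≤ l}, f lam

theorem eta_eq_zero_of_abs_le {z lam : ℝ} (h : |z| ≤ lam) : eta z lam = 0 := by
  simp [eta, max_eq_right (sub_nonpos.mpr h)]

theorem mul_eta_nonpos_of_sign_ne {β z : ℝ} (hβ : β ≠ 0) (hz : z ≠ 0)
    (h : Real.sign β ≠ Real.sign z) (lam : ℝ) : β * eta z lam ≤ 0 := by
  have hm : 0 ≤ max (|z| - lam) 0 := le_max_right _ _
  rw [eta]
  rcases hβ.lt_or_gt with hβ | hβ <;> rcases hz.lt_or_gt with hz | hz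
  · exact absurd (by rw [Real.sign_of_neg hβ, Real.sign_of_neg hz]) h
  · rw [Real.sign_of_pos hz, one_mul]
    exact mul_nonpos_of_nonpos_of_nonneg hβ.le hm
  · rw [Real.sign_of_neg hz, neg_one_mul]
    exact mul_nonpos_of_nonneg_of_nonpos hβ.le (neg_nonpos.mpr hm)
  · exact absurd (by rw [Real.sign_of_pos hβ, Real.sign_of_pos hz]) h

theorem sq_le_nLp_of_sign_ne (p : ℕ) (z : ℕ → ℝ) {β₁ : ℝ} (hβ : β₁ ≠ 0) (hz : z 1 ≠ 0)
    (h : Real.sign β₁ ≠ Real.sign (z 1)) (lam : ℝ) : β₁ ^ 2 ≤ nLp p z β₁ lam := by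
  have hsum : 0 ≤ ∑ j ∈ Finset.Icc 2 p, (eta (z j) lam) ^ 2 :=
    Finset.sum_nonneg fun _ _ => sq_nonneg _
  have hcross := mul_eta_nonpos_of_sign_ne hβ hz h lam
  rw [nLp]
  nlinarith [sq_nonneg (eta (z 1) lam)]

theorem nLp_eq_sq_of_abs_le {p : ℕ} (hp : 1 ≤ p) {z : ℕ → ℝ} (β₁ : ℝ) {lam : ℝ}
    (h : ∀ j ∈ Finset.Icc 1 p, |z j| ≤ lam) : nLp p z β₁ lam = β₁ ^ 2 := by
  have hsum : ∑ j ∈ Finset.Icc 2 p, (eta (z j) lam) ^ 2 = 0 :=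
    Finset.sum_eq_zero fun j hj => by
      rw [eta_eq_zero_of_abs_le (h j (Finset.Icc_subset_Icc_left one_le_two hj)), sq, mul_zero]
  rw [nLp, hsum, eta_eq_zero_of_abs_le (h 1 (Finset.left_mem_Icc.mpr hp)), sub_zero, add_zero]

/-- (Lemma 2.2) If `β₁ ≠ 0`, `z₁ ≠ 0` and `sgn(β₁) ≠ sgn(z₁)`, then the minimal scaled Lasso
loss equals `β₁²`, i.e. `inf_{λ≥0} nL_p(λ) = β₁²`; in particular `nL_p(λ) ≥ β₁²` for all
`λ ≥ 0`. -/
theorem lasso_wrong_sign_no_improvement (p : ℕ) (hp : 1 ≤ p) (z : ℕ → ℝ) (β₁ : ℝ)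
    (hβ : β₁ ≠ 0) (hz : z 1 ≠ 0) (hsgn : Real.sign β₁ ≠ Real.sign (z 1)) :
    infLoss (nLp p z β₁) = β₁ ^ 2 ∧ ∀ lam : ℝ, 0 ≤ lam → β₁ ^ 2 ≤ nLp p z β₁ lam := by
  have hle := sq_le_nLp_of_sign_ne p z hβ hz hsgn
  refine ⟨?_, fun lam _ => hle lam⟩
  have hmax : nLp p z β₁ (∑ j ∈ Finset.Icc 1 p, |z j|) = β₁ ^ 2 :=
    nLp_eq_sq_of_abs_le hp β₁ fun j hj =>
      Finset.single_le_sum (f := fun j => |z j|) (fun _ _ => abs_nonneg _) hj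
  have hleast : IsLeast (Set.range fun lam : {l : ℝ // 0 ≤ l} => nLp p z β₁ lam) (β₁ ^ 2) :=
    ⟨⟨⟨∑ j ∈ Finset.Icc 1 p, |z j|, Finset.sum_nonneg fun _ _ => abs_nonneg _⟩, hmax⟩,
      Set.forall_mem_range.mpr fun lam => hle lam⟩
  exact hleast.csInf_eq
end

section
/- (Lemma 2.5) Suppose p > 1, β_1 ≠ 0, z_1 ≠ 0, sgn(β_1) = sgn(z_1), and max_{2≤j≤p} |z_j| > |z_1|. Then strict deterioration occurs: inf_{λ≥0} nL_p(λ) > inf_{λ≥0} nL_1(λ). -/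
open Finset

lemma eta_sq {z : ℝ} (hz : z ≠ 0) (lam : ℝ) : eta z lam ^ 2 = max (|z| - lam) 0 ^ 2 := by
  rcases lt_or_gt_of_ne hz with h | h
  · simp [eta, Real.sign_of_neg h]
  · simp [eta, Real.sign_of_pos h]

/-- When the signs of `β₁` and `z₁` agree, the one-predictor loss depends only on their absolute
values. -/
lemma nL1_eq_of_sign_eq {z : ℕ → ℝ} {β₁ : ℝ} (hz : z 1 ≠ 0)
    (hsgn : Real.sign β₁ = Real.sign (z 1)) (lam : ℝ) :
    nL1 z β₁ lam = (|β₁| - max (|z 1| - lam) 0) ^ 2 := by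
  have hβ : β₁ = Real.sign (z 1) * |β₁| := by
    rcases lt_trichotomy β₁ 0 with h | h | h
    · rw [← hsgn, Real.sign_of_neg h, abs_of_neg h]; ring
    · simp [h]
    · rw [← hsgn, Real.sign_of_pos h, abs_of_pos h]; ring
  have hs : Real.sign (z 1) ^ 2 = 1 := by
    rcases Real.sign_apply_eq_of_ne_zero _ hz with h | h <;> simp [h]
  calc nL1 z β₁ lam
      = (Real.sign (z 1) * |β₁| - Real.sign (z 1) * max (|z 1| - lam) 0) ^ 2 := by
        rw [← hβ]; rfl
    _ = Real.sign (z 1) ^ 2 * (|β₁| - max (|z 1| - lam) 0) ^ 2 := by ring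
    _ = _ := by rw [hs, one_mul]

lemma infLoss_nL1_le (z : ℕ → ℝ) (β₁ : ℝ) {lam : ℝ} (hlam : 0 ≤ lam) :
    infLoss (nL1 z β₁) ≤ nL1 z β₁ lam :=
  ciInf_le (f := fun l : {l : ℝ // 0 ≤ l} => nL1 z β₁ l)
    ⟨0, by rintro _ ⟨l, rfl⟩; exact sq_nonneg _⟩ ⟨lam, hlam⟩

/-- The best one-predictor loss is strictly smaller than the loss of the null model. -/
lemma infLoss_nL1_lt_sq {z : ℕ → ℝ} {β₁ : ℝ} (hβ : β₁ ≠ 0) (hz : z 1 ≠ 0)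
    (hsgn : Real.sign β₁ = Real.sign (z 1)) : infLoss (nL1 z β₁) < |β₁| ^ 2 := by
  have hb := abs_pos.mpr hβ
  have ha := abs_pos.mpr hz
  refine (infLoss_nL1_le z β₁ (le_max_right (|z 1| - |β₁|) 0)).trans_lt ?_
  rw [nL1_eq_of_sign_eq hz hsgn]
  rcases le_total |z 1| |β₁| with h | h
  · rw [max_eq_right (sub_nonpos.mpr h), sub_zero, max_eq_left ha.le]
    nlinarith
  · rw [max_eq_left (sub_nonneg.mpr h), sub_sub_cancel, max_eq_left hb.le]
    nlinarith

/-- (Lemma 2.5) Suppose `p > 1`, `β₁ ≠ 0`, `z₁ ≠ 0`, `sgn(β₁) = sgn(z₁)`, and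
`max_{2≤j≤p} |z_j| > |z₁|`.  Then strict deterioration occurs:
`inf_{λ≥0} nL_p(λ) > inf_{λ≥0} nL_1(λ)`. -/
theorem lasso_always_deteriorates (p : ℕ) (hp : 1 < p) (z : ℕ → ℝ) (β₁ : ℝ)
    (hβ : β₁ ≠ 0) (hz : z 1 ≠ 0) (hsgn : Real.sign β₁ = Real.sign (z 1))
    (hmax : |z 1| < (Finset.Icc 2 p).sup' (Finset.nonempty_Icc.mpr hp) (fun j => |z j|)) :
    infLoss (nL1 z β₁) < infLoss (nLp p z β₁) := by
  obtain ⟨j, hj, hlt⟩ := (Finset.lt_sup'_iff _).mp hmax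
  have hI := infLoss_nL1_lt_sq hβ hz hsgn
  have hzj : z j ≠ 0 := abs_pos.mp ((abs_nonneg _).trans_lt hlt)
  have hgap : 0 < min ((|z j| - |z 1|) ^ 2) (|β₁| ^ 2 - infLoss (nL1 z β₁)) :=
    lt_min (pow_pos (sub_pos.mpr hlt) 2) (sub_pos.mpr hI)
  refine (lt_add_of_pos_right _ hgap).trans_le ?_
  have : Nonempty {l : ℝ // 0 ≤ l} := ⟨⟨0, le_rfl⟩⟩
  refine le_ciInf fun ⟨lam, hlam⟩ => ?_
  have hsplit : nLp p z β₁ lam = nL1 z β₁ lam + ∑ i ∈ Finset.Icc 2 p, eta (z i) lam ^ 2 := rfl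
  have hsum : eta (z j) lam ^ 2 ≤ ∑ i ∈ Finset.Icc 2 p, eta (z i) lam ^ 2 :=
    Finset.single_le_sum (f := fun i => eta (z i) lam ^ 2) (fun i _ => sq_nonneg _) hj
  rcases le_total lam |z 1| with h | h
  · have hsq : (|z j| - |z 1|) ^ 2 ≤ eta (z j) lam ^ 2 := by
      rw [eta_sq hzj, max_eq_left (by linarith)]
      gcongr
    linarith [min_le_left ((|z j| - |z 1|) ^ 2) (|β₁| ^ 2 - infLoss (nL1 z β₁)),
      infLoss_nL1_le z β₁ hlam]
  · have hnull : nL1 z β₁ lam = |β₁| ^ 2 := by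
      rw [nL1_eq_of_sign_eq hz hsgn, max_eq_right (sub_nonpos.mpr h), sub_zero]
    linarith [min_le_right ((|z j| - |z 1|) ^ 2) (|β₁| ^ 2 - infLoss (nL1 z β₁)),
      sq_nonneg (eta (z j) lam)]
end
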